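/- Let k, β, M be integers with 1 ≤ k ≤ β, β − k odd, and M ≥ β + 1. Then Σ_{h=β+1}^{M} (−1)^{h−k} · C(h−1, k−1) · C(M, h) ≥ 0. -/

import Mathlib

/-- Partial sums of an alternating row of Pascal's triangle, starting from column `m + 1`. -/
theorem alternating_sum_choose_tail (n m N : ℕ) :
    ∑ i ∈ Finset.range N, (-1 : ℤ) ^ i * ((n + 1).choose (m + 1 + i)) =
      n.choose m - (-1) ^ N * n.choose (m + N) := by
  induction N with
  | zero => simp
  | succ N ih =>
    rw [Finset.sum_range_succ, ih, show m + 1 + N = (m + N) + 1 by ring, Nat.choose_succ_succ',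
      ← add_assoc]
    push_cast
    ring

/-- The alternating tail sums of `C(j, a) * C(M, j)` over `j ≥ a + b + 1` are nonnegative. -/
theorem alternating_sum_choose_mul_choose_nonneg (a b M N : ℕ) (hN : M ≤ N) :
    0 ≤ ∑ i ∈ Finset.range N,
      (-1 : ℤ) ^ i * ((a + b + 1 + i).choose a) * (M.choose (a + b + 1 + i)) := by
  have key : ∀ i, (-1 : ℤ) ^ i * ((a + b + 1 + i).choose a) * (M.choose (a + b + 1 + i)) =
      M.choose a * ((-1 : ℤ) ^ i * ((M - a).choose (b + 1 + i))) := by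
    intro i
    have h : M.choose (a + b + 1 + i) * (a + b + 1 + i).choose a =
        M.choose a * (M - a).choose (b + 1 + i) := by
      rw [Nat.choose_mul (by omega), show a + b + 1 + i - a = b + 1 + i by omega]
    have h' : (M.choose (a + b + 1 + i) * (a + b + 1 + i).choose a : ℤ) =
        M.choose a * (M - a).choose (b + 1 + i) := mod_cast h
    linear_combination (-1 : ℤ) ^ i * h'
  simp only [key, ← Finset.mul_sum]
  refine mul_nonneg (by positivity) ?_
  rcases hn : M - a with _ | n
  · refine Finset.sum_nonneg fun i _ => ?_
    rw [Nat.choose_eq_zero_of_lt (by omega)]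
    simp
  · rw [alternating_sum_choose_tail, Nat.choose_eq_zero_of_lt (show n < b + N by omega)]
    simp

/-- The alternating tail sums of `C(h - 1, a) * C(M, h)` over `h ≥ a + b + 2` are nonnegative. -/
theorem alternating_sum_choose_pred_mul_choose_nonneg (a b M N : ℕ) (hN : M ≤ N) :
    0 ≤ ∑ i ∈ Finset.range N,
      (-1 : ℤ) ^ i * ((a + b + 1 + i).choose a) * (M.choose (a + b + 1 + i + 1)) := by
  induction M with
  | zero => simp
  | succ M ih =>
    simp only [Nat.choose_succ_succ' M, Nat.cast_add, mul_add, Finset.sum_add_distrib]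
    exact add_nonneg (alternating_sum_choose_mul_choose_nonneg a b M N (by omega))
      (ih (by omega))

/-- **Lemma (tail sum, odd case).** Let `k, β, M` be integers with `1 ≤ k ≤ β`,
`β − k` odd, and `M ≥ β + 1`. Then
`Σ_{h=β+1}^{M} (−1)^{h−k} · C(h−1, k−1) · C(M, h) ≥ 0`. -/
theorem stmt11 (k β M : ℕ) (hk : 1 ≤ k) (hkβ : k ≤ β) (hodd : Odd (β - k))
    (hM : β + 1 ≤ M) :
    0 ≤ ∑ h ∈ Finset.Icc (β + 1) M,
        ((-1 : ℤ)) ^ (h - k) * ((h - 1).choose (k - 1)) * (M.choose h) := by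
  obtain ⟨a, rfl⟩ := Nat.exists_eq_add_of_le' hk
  obtain ⟨b, rfl⟩ := Nat.exists_eq_add_of_le hkβ
  have hb : Even (b + 1) := by
    rw [Nat.add_sub_cancel_left] at hodd
    exact hodd.add_one
  refine (alternating_sum_choose_pred_mul_choose_nonneg a b M M le_rfl).trans_eq ?_
  rw [← Finset.Ico_add_one_right_eq_Icc, Finset.sum_Ico_eq_sum_range]
  symm
  refine (Finset.sum_congr rfl fun i _ => ?_).trans
    (Finset.sum_subset (Finset.range_mono (by omega)) fun i _ hi => ?_)
  · rw [show a + 1 + b + 1 + i - (a + 1) = (b + 1) + i by omega, pow_add, hb.neg_one_pow, one_mul,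
      show a + 1 + b + 1 + i - 1 = a + b + 1 + i by omega, Nat.add_sub_cancel,
      show a + 1 + b + 1 + i = a + b + 1 + i + 1 by omega]
  · rw [Finset.mem_range] at hi
    rw [Nat.choose_eq_zero_of_lt (show M < a + b + 1 + i + 1 by omega)]
    simp
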